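/- Let k be a field with char k ≠ 2, V a 3-dimensional k-vector space, ζ an invertible linear operator on V, and R a Hecke symmetry on V with parameter q such that Im(R − q·Id_{V⊗V}) = span{ζ(x)⊗y − ζ(y)⊗x : x,y ∈ V} (equivalently, the identity map of V extends to an isomorphism of algebras S(V,R) ≅ S(V)_ζ). Then R commutes with ζ⊗ζ, i.e. (ζ⊗ζ)∘R = R∘(ζ⊗ζ). Consequently, R_{ζ⁻¹} := (ζ⁻¹⊗Id_V)∘R∘(ζ⊗Id_V) is a Hecke symmetry with parameter q satisfying Im(R_{ζ⁻¹} − q·Id_{V⊗V}) = span{x⊗y − y⊗x : x,y ∈ V}, i.e. S(V,R_{ζ⁻¹}) = S(V), so R is a twist by ζ of a Hecke symmetry whose associated R-symmetric algebra is the ordinary symmetric algebra S(V). -/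

import Mathlib

open TensorProduct LinearMap

noncomputable section

variable (k V : Type) [Field k] [AddCommGroup V] [Module k V]

/-- `R ⊗ Id` acting on `V ⊗ (V ⊗ V)`. -/
def op12 (R : V ⊗[k] V →ₗ[k] V ⊗[k] V) :
    V ⊗[k] (V ⊗[k] V) →ₗ[k] V ⊗[k] (V ⊗[k] V) :=
  (TensorProduct.assoc k V V V).toLinearMap ∘ₗ LinearMap.rTensor V R ∘ₗ
    (TensorProduct.assoc k V V V).symm.toLinearMap

/-- `Id ⊗ R` acting on `V ⊗ (V ⊗ V)`. -/
def op23 (R : V ⊗[k] V →ₗ[k] V ⊗[k] V) :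
    V ⊗[k] (V ⊗[k] V) →ₗ[k] V ⊗[k] (V ⊗[k] V) :=
  LinearMap.lTensor V R

/-- A Hecke symmetry with parameter `q`. -/
def IsHeckeSymmetry (q : k) (R : V ⊗[k] V →ₗ[k] V ⊗[k] V) : Prop :=
  q ≠ 0 ∧
    op12 k V R ∘ₗ op23 k V R ∘ₗ op12 k V R = op23 k V R ∘ₗ op12 k V R ∘ₗ op23 k V R ∧
    (R - q • LinearMap.id) ∘ₗ (R + LinearMap.id) = 0

section Core
set_option maxSynthPendingDepth 3
variable {k}

/-- Trilinear forms on `k³`. -/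
abbrev Trilin (k : Type) [Field k] :=
  (Fin 3 → k) →ₗ[k] (Fin 3 → k) →ₗ[k] (Fin 3 → k) →ₗ[k] k

/-- The determinant of three vectors in `k³`. -/
def det3 (x y z : Fin 3 → k) : k :=
  x 0 * (y 1 * z 2 - y 2 * z 1) + x 1 * (y 2 * z 0 - y 0 * z 2) + x 2 * (y 0 * z 1 - y 1 * z 0)

/-- The standard basis vectors of `k³`. -/
def stdVec (i : Fin 3) : Fin 3 → k := Pi.single i 1

lemma eq_sum_stdVec (x : Fin 3 → k) :
    x = x 0 • stdVec 0 + x 1 • stdVec 1 + x 2 • stdVec 2 := by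
  ext i; fin_cases i <;> simp [stdVec]

lemma apply_eq_coords (φ : (Fin 3 → k) →ₗ[k] k) (x : Fin 3 → k) :
    φ x = x 0 * φ (stdVec 0) + x 1 * φ (stdVec 1) + x 2 * φ (stdVec 2) := by
  conv_lhs => rw [eq_sum_stdVec x]
  simp

lemma det3_plucker (φ : (Fin 3 → k) →ₗ[k] k) (x y z w : Fin 3 → k) :
    det3 y z w * φ x - det3 x z w * φ y + det3 x y w * φ z - det3 x y z * φ w = 0 := by
  rw [apply_eq_coords φ x, apply_eq_coords φ y, apply_eq_coords φ z, apply_eq_coords φ w]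
  simp only [det3]
  ring

/-- A nonzero vector extends to a triple with nonzero determinant. -/
lemma exists_det3_ne_zero {x : Fin 3 → k} (hx : x ≠ 0) : ∃ y z, det3 x y z ≠ 0 := by
  by_contra! h
  apply hx
  have h0 := h (stdVec 1) (stdVec 2)
  have h1 := h (stdVec 2) (stdVec 0)
  have h2 := h (stdVec 0) (stdVec 1)
  simp [det3, stdVec] at h0 h1 h2
  ext i; fin_cases i <;> simp [h0, h1, h2]

/-- A vector outside the kernel of a functional is completed by two vectors of the kernel. -/
lemma exists_ker_complement (φ : (Fin 3 → k) →ₗ[k] k) {u : Fin 3 → k} (hu : φ u ≠ 0) :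
    ∃ y z, φ y = 0 ∧ φ z = 0 ∧ det3 u y z ≠ 0 := by
  obtain ⟨y, z, h⟩ := exists_det3_ne_zero (x := u) (by rintro rfl; simp at hu)
  refine ⟨y - (φ y / φ u) • u, z - (φ z / φ u) • u, by simp [hu], by simp [hu], ?_⟩
  convert h using 1
  simp only [det3, Pi.sub_apply, Pi.smul_apply, smul_eq_mul]
  ring

/-- A linear form on `k³` vanishing on three independent vectors is zero. -/
lemma eq_zero_of_det3 (φ : (Fin 3 → k) →ₗ[k] k) {x y z : Fin 3 → k} (h : det3 x y z ≠ 0)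
    (hx : φ x = 0) (hy : φ y = 0) (hz : φ z = 0) (w : Fin 3 → k) : φ w = 0 := by
  have := det3_plucker φ x y z w
  rw [hx, hy, hz] at this
  have h' : det3 x y z * φ w = 0 := by linear_combination -this
  exact (mul_eq_zero.mp h').resolve_left h

/-- A trilinear form symmetric in its first two arguments is recovered from the values at
`(x, u, u)`. -/
lemma trilin_eq_zero (h2 : (2 : k) ≠ 0) (θ : Trilin k) (hs : ∀ x y z, θ x y z = θ y x z)
    (h : ∀ x u, θ x u u = 0) (x y z : Fin 3 → k) : θ x y z = 0 := by
  have hp : ∀ x y z, θ x y z + θ x z y = 0 := fun x y z => by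
    have := h x (y + z)
    simp only [map_add, LinearMap.add_apply] at this
    linear_combination this - h x y - h x z
  have : 2 * θ x y z = 0 := by
    linear_combination hp x y z + hp y x z - hp z x y + hs x y z - hs x z y - hs y z x
  exact (mul_eq_zero.mp this).resolve_left h2

section Quadratic
variable {p d : k} {δ ρ σ : Trilin k}

/-- The quadratic relation satisfied by a pair of trilinear forms. -/
def QuadRel (p d : k) (δ ρ σ : Trilin k) : Prop := ∀ u v x y z,
  ρ x v u * σ y z u - ρ x u u * σ y z v - ρ y v u * σ x z u + ρ y u u * σ x z v =
    p * (det3 u v x * δ y z u - det3 u v y * δ x z u) - d * (det3 x y u * det3 u v z)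

lemma QuadRel.wedge (h : QuadRel p d δ ρ σ) (h' : QuadRel p d δ σ ρ)
    (u v x y : Fin 3 → k) :
    ρ x u u * σ y v v + σ x u u * ρ y v v - ρ y u u * σ x v v - σ y u u * ρ x v v =
      -2 * p * (det3 u v x * δ y v u - det3 u v y * δ x v u) := by
  have e : det3 u v v = 0 := by simp only [det3]; ring
  linear_combination -h u v x y v - h' u v x y v + 2 * d * det3 x y u * e

lemma QuadRel.twist (h : QuadRel p d δ ρ σ) (h' : QuadRel p d δ σ ρ)
    (u v x y z : Fin 3 → k) :
    ρ x u u * (σ y z v - σ y v z) - ρ y u u * (σ x z v - σ x v z) =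
      σ x u u * (ρ y z v - ρ y v z) - σ y u u * (ρ x z v - ρ x v z) := by
  linear_combination -h u v x y z + h u z x y v + h' u v x y z - h' u z x y v

lemma QuadRel.trace (h : QuadRel p d δ ρ σ)
    (hρ : ∀ x y z, ρ x y z = ρ y x z) (hσ : ∀ x y z, σ x y z = σ y x z)
    (hδ : ∀ x y z, δ x y z = δ y x z) (u x y z : Fin 3 → k) :
    ρ x u u * (σ x y z - σ x z y) + ρ y u u * (σ x z x - σ x x z)
      + ρ z u u * (σ x x y - σ x y x) = -2 * p * det3 x y z * δ x u u := by
  have a1 := h u x x y z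
  have a2 := h u z x y x
  have a3 := h u x x z y
  have a4 := h u y x z x
  have pl := det3_plucker ((δ x).flip u) u x y z
  simp only [LinearMap.flip_apply] at pl
  simp only [hρ y x, hρ z x, hρ z y, hσ y x, hσ z x, hσ z y, hδ y x, hδ z x, hδ z y, det3]
    at a1 a2 a3 a4 pl ⊢
  linear_combination a1 - a2 - a3 + a4 + 2 * p * pl

end Quadratic

/-- Exchange the last two arguments of a trilinear form. -/
def Trilin.flipRight (t : Trilin k) : Trilin k where
  toFun x := (t x).flip
  map_add' x y := by ext; simp
  map_smul' c x := by ext; simp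

/-- An alternating trilinear form on `k³` is a multiple of the determinant. -/
lemma exists_eq_mul_det3 (t : Trilin k) (h₁ : ∀ x y, t x y y = 0) (h₂ : ∀ x y, t x y x = 0) :
    ∃ c, ∀ x y z, t x y z = c * det3 x y z := by
  have s₁ : ∀ x y z, t x y z = - t x z y := fun x y z => by
    have := h₁ x (y + z)
    simp only [map_add, LinearMap.add_apply, h₁] at this
    linear_combination this
  have s₂ : ∀ x y z, t x y z = - t z y x := fun x y z => by
    have := h₂ (x + z) y
    simp only [map_add, LinearMap.add_apply, h₂] at this
    linear_combination this
  have h₃ : ∀ x y, t x x y = 0 := fun x y => by rw [s₁, h₂, neg_zero]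
  refine ⟨t (stdVec 0) (stdVec 1) (stdVec 2), fun x y z => ?_⟩
  conv_lhs => rw [eq_sum_stdVec x, eq_sum_stdVec y, eq_sum_stdVec z]
  simp only [map_add, map_smul, LinearMap.add_apply, LinearMap.smul_apply, smul_eq_mul, h₁, h₂, h₃,
    det3]
  rw [s₁ (stdVec 0) (stdVec 2) (stdVec 1), s₂ (stdVec 2) (stdVec 1) (stdVec 0),
    s₁ (stdVec 2) (stdVec 0) (stdVec 1), s₂ (stdVec 2) (stdVec 1) (stdVec 0),
    s₂ (stdVec 1) (stdVec 2) (stdVec 0), s₁ (stdVec 1) (stdVec 0) (stdVec 2),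
    s₂ (stdVec 1) (stdVec 2) (stdVec 0), s₁ (stdVec 0) (stdVec 2) (stdVec 1)]
  ring

section Quadratic
variable {p d : k} {δ ρ σ : Trilin k}

/-- A pair of trilinear forms, symmetric in the first two arguments, satisfying the quadratic
relation in both orders, together with their difference. -/
structure QuadPair (p d : k) (δ ρ σ : Trilin k) : Prop where
  symm_left : ∀ x y z, ρ x y z = ρ y x z
  symm_right : ∀ x y z, σ x y z = σ y x z
  eq_add : ∀ x y z, ρ x y z = σ x y z + δ x y z
  rel : QuadRel p d δ ρ σ
  rel' : QuadRel p d δ σ ρ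

lemma QuadPair.symm_diff (h : QuadPair p d δ ρ σ) (x y z : Fin 3 → k) : δ x y z = δ y x z := by
  linear_combination h.eq_add y x z - h.eq_add x y z + h.symm_left x y z - h.symm_right x y z

lemma QuadPair.diff_rotate (h : QuadPair p d δ ρ σ) (h2 : (2 : k) ≠ 0) (hp : p ≠ 0)
    (u v : Fin 3 → k) : δ u v u = δ u u v := by
  have key : ∀ v x, det3 u v x * (δ u v u - δ u u v) = 0 := fun v x => by
    have e : det3 u v u = 0 := by simp only [det3]; ring
    have e' : det3 v u x = - det3 u v x := by simp only [det3]; ring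
    have e'' : det3 v u u = 0 := by simp only [det3]; ring
    have : (2 * p) * (det3 u v x * (δ u v u - δ u u v)) = 0 := by
      have h1 := h.rel.wedge h.rel' u v x u
      have h3 := h.rel.wedge h.rel' v u x u
      rw [e] at h1
      rw [e', e''] at h3
      linear_combination h1 + h3
    exact (mul_eq_zero.mp this).resolve_left (mul_ne_zero h2 hp)
  by_cases hu : u = 0
  · simp [hu]
  obtain ⟨y, z, hD⟩ := exists_det3_ne_zero hu
  have hD' : det3 u z y ≠ 0 := by
    convert neg_ne_zero.mpr hD using 1
    simp only [det3]; ring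
  refine sub_eq_zero.mp (eq_zero_of_det3 ((δ u).flip u - δ u u) hD ?_ ?_ ?_ v)
  · simp
  · simpa using (mul_eq_zero.mp (key y z)).resolve_left hD
  · simpa using (mul_eq_zero.mp (key z y)).resolve_left hD'

lemma QuadPair.exists_skew (h : QuadPair p d δ ρ σ) (h2 : (2 : k) ≠ 0) (hp : p ≠ 0) :
    ∃ l, (∀ x y z, δ x y z - δ x z y = l * det3 x y z) ∧ 3 * l = 0 := by
  obtain ⟨l, hl⟩ := exists_eq_mul_det3 (δ - δ.flipRight)
    (fun x y => by simp [Trilin.flipRight])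
    (fun x y => by simp [Trilin.flipRight, h.diff_rotate h2 hp])
  replace hl : ∀ x y z, δ x y z - δ x z y = l * det3 x y z := fun x y z => by
    simpa [Trilin.flipRight] using hl x y z
  refine ⟨l, hl, ?_⟩
  have e1 := hl (stdVec 0) (stdVec 1) (stdVec 2)
  have e2 := hl (stdVec 1) (stdVec 2) (stdVec 0)
  have e3 := hl (stdVec 2) (stdVec 0) (stdVec 1)
  simp only [h.symm_diff (stdVec 1) (stdVec 0), h.symm_diff (stdVec 2) (stdVec 0),
    h.symm_diff (stdVec 2) (stdVec 1)] at e1 e2 e3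
  simp [det3, stdVec] at e1 e2 e3
  linear_combination -e1 - e2 - e3

lemma QuadPair.twist_diff (h : QuadPair p d δ ρ σ) {l : k}
    (hl : ∀ x y z, δ x y z - δ x z y = l * det3 x y z) (u v x y z : Fin 3 → k) :
    δ x u u * (σ y z v - σ y v z) - δ y u u * (σ x z v - σ x v z) =
      l * (σ x u u * det3 y z v - σ y u u * det3 x z v) := by
  have := h.rel.twist h.rel' u v x y z
  simp only [h.eq_add] at this
  linear_combination this + σ x u u * hl y z v - σ y u u * hl x z v

lemma QuadPair.diff_eq_zero_of_symm (h : QuadPair p d δ ρ σ) (h2 : (2 : k) ≠ 0) (hp : p ≠ 0)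
    (hs : ∀ x y z, δ x y z = δ x z y) (x u : Fin 3 → k) : δ x u u = 0 := by
  by_contra hx
  have tw := h.twist_diff (l := 0) (by simp [← hs])
  have ht : ∀ y, δ y u u = 0 → ∀ z v, σ y z v = σ y v z := fun y hy z v => by
    have := tw u v x y z
    rw [hy] at this
    have : δ x u u * (σ y z v - σ y v z) = 0 := by linear_combination this
    exact sub_eq_zero.mp ((mul_eq_zero.mp this).resolve_left hx)
  have hker : ∀ y, δ y u u = 0 → ∀ a b, δ y a b = 0 := fun y hy a b => by
    have hd : ∀ a, δ y a a = 0 := fun a => by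
      by_cases hy0 : y = 0
      · simp [hy0]
      obtain ⟨z, w, hD⟩ := exists_det3_ne_zero hy0
      have := h.rel.trace h.symm_left h.symm_right h.symm_diff a y z w
      rw [ht y hy z w, ht y hy w y, ht y hy y z] at this
      have : (2 * p * det3 y z w) * δ y a a = 0 := by linear_combination this
      exact (mul_eq_zero.mp this).resolve_left (mul_ne_zero (mul_ne_zero h2 hp) hD)
    have := hd (a + b)
    simp only [map_add, LinearMap.add_apply, hd, hs y b a] at this
    have : 2 * δ y a b = 0 := by linear_combination this
    exact (mul_eq_zero.mp this).resolve_left h2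
  have hker' : ∀ y, δ y u u = 0 → ∀ a b, δ a y b = 0 := fun y hy a b => by
    rw [h.symm_diff]; exact hker y hy a b
  have hker'' : ∀ y, δ y u u = 0 → ∀ a b, δ a b y = 0 := fun y hy a b => by
    rw [hs]; exact hker' y hy a b
  have hu : δ u u u ≠ 0 := fun hu => hx (hker' u hu x u)
  have main : ∀ m w a b, δ m u u = 0 → δ w u u = 0 →
      (2 * σ a (u + m) (u + m) + δ a u u) * (2 * σ b (u + m + w) (u + m + w) + δ b u u) -
      (2 * σ b (u + m) (u + m) + δ b u u) * (2 * σ a (u + m + w) (u + m + w) + δ a u u) =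
      -4 * p * (det3 (u + m) w a * δ b u u - det3 (u + m) w b * δ a u u) := fun m w a b hm hw => by
    have := h.rel.wedge h.rel' (u + m) (u + m + w) a b
    have e : ∀ a, det3 (u + m) (u + m + w) a = det3 (u + m) w a := fun a => by
      simp only [det3, Pi.add_apply]; ring
    have f : ∀ a, δ a (u + m) (u + m) = δ a u u := fun a => by
      simp [hker' m hm, hker'' m hm]
    have g : ∀ a, δ a (u + m + w) (u + m) = δ a u u := fun a => by
      simp [hker' m hm, hker'' m hm, hker' w hw]
    have f' : ∀ a, δ a (u + m + w) (u + m + w) = δ a u u := fun a => by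
      simp [hker' m hm, hker'' m hm, hker' w hw, hker'' w hw]
    simp only [h.eq_add, e, f, g, f'] at this
    linear_combination 2 * this
  have vanish : ∀ m w c, δ m u u = 0 → δ w u u = 0 → δ c u u = 0 → det3 (u + m) w c ≠ 0 →
      σ w (u + m) (u + m) = 0 := fun m w c hm hw hc hD => by
    have h1 := main m w u w hm hw
    have h3 := main m w w c hm hw
    have h4 := main m w c u hm hw
    rw [hw] at h1 h3
    rw [hc] at h3 h4
    have e : det3 (u + m) w w = 0 := by simp only [det3]; ring
    rw [e] at h1 h3
    have : (4 * p * det3 (u + m) w c * δ u u u * 2) * σ w (u + m) (u + m) = 0 := by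
      linear_combination (2 * σ u (u + m) (u + m) + δ u u u) * h3
        + (2 * σ w (u + m) (u + m)) * h4 + (2 * σ c (u + m) (u + m)) * h1
    have h4' : (4 : k) ≠ 0 := by
      convert mul_ne_zero h2 h2 using 1; norm_num
    exact (mul_eq_zero.mp this).resolve_left
      (mul_ne_zero (mul_ne_zero (mul_ne_zero (mul_ne_zero h4' hp) hD) hu) h2)
  obtain ⟨w, c, hw, hc, hD⟩ := exists_ker_complement (((δ.flip u).flip) u) (u := u) (by simpa)
  simp only [LinearMap.flip_apply] at hw hc
  have hw : δ w u u = 0 := by simpa using hw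
  have hc : δ c u u = 0 := by simpa using hc
  have e1 := vanish 0 c w (by simp) hc hw (by
    convert neg_ne_zero.mpr hD using 1
    simp only [det3, Pi.add_apply, Pi.zero_apply]; ring)
  have e2 := vanish w c w hw hc hw (by
    convert neg_ne_zero.mpr hD using 1
    simp only [det3, Pi.add_apply]; ring)
  have := main 0 w c u (by simp) hw
  simp only [add_zero] at this e1
  rw [e1, e2, hc] at this
  have h4' : (4 : k) ≠ 0 := by
    convert mul_ne_zero h2 h2 using 1; norm_num
  apply mul_ne_zero (mul_ne_zero (mul_ne_zero h4' hp) hD) hu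
  linear_combination this

lemma exists_diag_ne_zero_of_skew (h2 : (2 : k) ≠ 0) {l : k} (hl0 : l ≠ 0)
    (hs : ∀ x y z, δ x y z = δ y x z) (hl : ∀ x y z, δ x y z - δ x z y = l * det3 x y z) :
    ∃ x u, δ x u u ≠ 0 := by
  by_contra! hx
  have h0 := trilin_eq_zero h2 δ hs hx
  have := hl (stdVec 0) (stdVec 1) (stdVec 2)
  simp [h0, det3, stdVec] at this
  exact hl0 this.symm

lemma QuadPair.exists_eq_mul_of_skew (h : QuadPair p d δ ρ σ) (h2 : (2 : k) ≠ 0) {l : k}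
    (hl0 : l ≠ 0) (h3 : (3 : k) = 0) (hl : ∀ x y z, δ x y z - δ x z y = l * det3 x y z) :
    ∃ c, ∀ x y z, σ x y z = c * δ x y z := by
  obtain ⟨x, v, hx⟩ := exists_diag_ne_zero_of_skew h2 hl0 h.symm_diff hl
  obtain ⟨y, z, hy, hz, hD⟩ := exists_ker_complement (((δ.flip v).flip) v) (u := x) (by simpa)
  replace hy : δ y v v = 0 := by simpa using hy
  replace hz : δ z v v = 0 := by simpa using hz
  have tw := h.twist_diff hl
  have hβy : σ y v v = 0 := by
    have := tw v y y z x
    rw [hy, hz] at this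
    have e : det3 z x y = det3 x y z := by simp only [det3]; ring
    have e' : det3 y x y = 0 := by simp only [det3]; ring
    rw [e, e'] at this
    apply (mul_eq_zero.mp _).resolve_left (mul_ne_zero hl0 hD)
    linear_combination -this
  have hβz : σ z v v = 0 := by
    have := tw v z y z x
    rw [hy, hz] at this
    have e : det3 z x z = 0 := by simp only [det3]; ring
    have e' : det3 y x z = - det3 x y z := by simp only [det3]; ring
    rw [e, e'] at this
    apply (mul_eq_zero.mp _).resolve_left (mul_ne_zero hl0 hD)
    linear_combination -this
  set c := σ x v v / δ x v v with hc
  have hβx : σ x v v = c * δ x v v := by rw [hc]; field_simp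
  have ht : ∀ w, δ w v v = 0 → σ w v v = 0 → ∀ a b,
      σ w a b - σ w b a = l * c * det3 w a b := fun w hw hw' a b => by
    have := tw v b x w a
    rw [hw, hw', hβx] at this
    apply mul_left_cancel₀ hx
    linear_combination this
  have ty := ht y hy hβy
  have tz := ht z hz hβz
  have tx : σ x y z - σ x z y = l * c * det3 x y z := by
    have e1 := ty z x
    have e2 := tz x y
    have e : det3 z x y = det3 x y z := by simp only [det3]; ring
    have e' : det3 y z x = det3 x y z := by simp only [det3]; ring
    rw [e'] at e1
    rw [e] at e2
    rw [h.symm_right y x] at e1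
    rw [h.symm_right z x, h.symm_right z y] at e2
    linear_combination -e1 - e2 - l * c * det3 x y z * h3
  have f1 : det3 z x y = det3 x y z := by simp only [det3]; ring
  have f2 : det3 y z x = det3 x y z := by simp only [det3]; ring
  have f3 : det3 y x y = 0 := by simp only [det3]; ring
  have f4 : det3 z z x = 0 := by simp only [det3]; ring
  have f5 : det3 x x y = 0 := by simp only [det3]; ring
  have f6 : det3 x z x = 0 := by simp only [det3]; ring
  have hDl := mul_ne_zero hl0 hD
  have dy : ∀ u, σ y u u = c * δ y u u := fun u => by
    have := tw u y y z x
    rw [tz, ty, f1, f3] at this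
    apply mul_left_cancel₀ hDl
    linear_combination -this
  have dz : ∀ u, σ z u u = c * δ z u u := fun u => by
    have := tw u x y z z
    rw [tz, ty, f2, f4] at this
    apply mul_left_cancel₀ hDl
    linear_combination this
  have dx : ∀ u, σ x u u = c * δ x u u := fun u => by
    have a1 := tw u y x y x
    have a2 := tw u x x y z
    have a3 := tw u x x z z
    have a4 := tw u y x z x
    rw [ty, dy, f3, f5] at a1
    rw [ty, dy, f2, f6] at a2
    rw [tz, dz, f4, f6] at a3
    rw [tz, dz, f1, f5] at a4
    set e := σ x u u - c * δ x u u with he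
    set n := σ x z x - σ x x z with hn
    set m := σ x x y - σ x y x with hm
    have b2 : δ y u u * n = - (l * det3 x y z * e) := by linear_combination -a2
    have b3 : δ z u u * n = 0 := by linear_combination -a3
    have b4 : δ z u u * m = - (l * det3 x y z * e) := by linear_combination -a4
    by_contra hne
    have he0 : e ≠ 0 := sub_ne_zero.mpr hne
    have hr := neg_ne_zero.mpr (mul_ne_zero hDl he0)
    rcases mul_eq_zero.mp b3 with h0 | h0
    · rw [h0, zero_mul] at b4
      exact hr b4.symm
    · rw [h0, mul_zero] at b2
      exact hr b2.symm
  refine ⟨c, fun a b w => ?_⟩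
  have := trilin_eq_zero h2 (σ - c • δ) (fun x y z => by
    simp [h.symm_right x y, h.symm_diff x y]) (fun a u => ?_) a b w
  · simpa [sub_eq_zero] using this
  · have := eq_zero_of_det3 (((σ - c • δ).flip u).flip u) hD (by simp [dx]) (by simp [dy])
      (by simp [dz]) a
    simpa using this

lemma QuadPair.skew_eq_zero (h : QuadPair p d δ ρ σ) (h2 : (2 : k) ≠ 0) (hp : p ≠ 0) {l : k}
    (h3 : 3 * l = 0) (hl : ∀ x y z, δ x y z - δ x z y = l * det3 x y z) : l = 0 := by
  by_contra hl0
  replace h3 : (3 : k) = 0 := (mul_eq_zero.mp h3).resolve_right hl0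
  obtain ⟨c, hc⟩ := h.exists_eq_mul_of_skew h2 hl0 h3 hl
  obtain ⟨x, v, hx⟩ := exists_diag_ne_zero_of_skew h2 hl0 h.symm_diff hl
  obtain ⟨y, z, hy, hz, hD⟩ := exists_ker_complement (((δ.flip v).flip) v) (u := x) (by simpa)
  replace hy : δ y v v = 0 := by simpa using hy
  replace hz : δ z v v = 0 := by simpa using hz
  have hρ : ∀ x y z, ρ x y z = (c + 1) * δ x y z := fun x y z => by
    rw [h.eq_add, hc]; ring
  have hcl : c * (c + 1) * l = -2 * p := by
    have := h.rel.trace h.symm_left h.symm_right h.symm_diff v x y z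
    simp only [hρ, hc, hy, hz] at this
    apply mul_right_cancel₀ (mul_ne_zero hD hx)
    linear_combination this - (c + 1) * δ x v v * c * hl x y z
  have hcc : c * (c + 1) ≠ 0 := fun e => by
    rw [e, zero_mul] at hcl
    exact mul_ne_zero h2 hp (by linear_combination hcl)
  have quad : ∀ u x y a b, (c * (c + 1)) * (δ x a u * δ y b u - δ y a u * δ x b u) =
      - d * (det3 x y u * det3 u a b) := fun u x y a b => by
    have e1 := h.rel u a x y b
    have e2 := h.rel u b x y a
    have pl1 := det3_plucker ((δ y).flip u) u a b x
    have pl2 := det3_plucker ((δ x).flip u) u a b y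
    have hxy := h.symm_diff y x u
    simp only [LinearMap.flip_apply] at pl1 pl2
    simp only [hρ, hc] at e1 e2
    have l1 := hl y b a
    have l2 := hl x b a
    apply mul_left_cancel₀ h2
    have D1 : det3 u b a = - det3 u a b := by simp only [det3]; ring
    have D2 : ∀ w, det3 w b a = - det3 a b w := fun w => by simp only [det3]; ring
    rw [D1] at e2
    rw [D2] at l1 l2
    linear_combination e1 - e2 + c * (c + 1) * δ x u u * l1 - c * (c + 1) * δ y u u * l2
      + (δ y u u * det3 a b x - δ x u u * det3 a b y) * hcl + p * (pl1 - pl2)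
      + p * (det3 a b y * δ x u u - det3 a b x * δ y u u) * h3 + p * det3 u a b * hxy
  have rank : ∀ y a b, δ a v v * δ y b v = δ y a v * δ b v v := fun y a b => by
    have := quad v v y a b
    have e : det3 v y v = 0 := by simp only [det3]; ring
    rw [e, h.symm_diff v a, h.symm_diff v b] at this
    apply mul_left_cancel₀ hcc
    linear_combination this
  have hv : δ v v v ≠ 0 := fun hv => by
    have := rank x x v
    rw [hv, mul_zero] at this
    exact mul_ne_zero hx hx this
  obtain ⟨s, t, hs, ht, hst⟩ := exists_ker_complement (((δ.flip v).flip) v) (u := v) (by simpa)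
  replace hs : δ s v v = 0 := by simpa using hs
  replace ht : δ t v v = 0 := by simpa using ht
  have hd : d = 0 := by
    have := quad v s t s t
    have e : det3 s t v = det3 v s t := by simp only [det3]; ring
    have hker : δ s s v = 0 := by
      have := rank s v s
      rw [hs, mul_zero] at this
      exact (mul_eq_zero.mp this).resolve_left hv
    have hker' : δ t s v = 0 := by
      have := rank t v s
      rw [hs, mul_zero] at this
      exact (mul_eq_zero.mp this).resolve_left hv
    rw [e, hker, hker'] at this
    have : d * (det3 v s t * det3 v s t) = 0 := by linear_combination this
    exact (mul_eq_zero.mp this).resolve_right (mul_ne_zero hst hst)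
  have minor : ∀ u x y a b, δ x a u * δ y b u - δ y a u * δ x b u = 0 := fun u x y a b => by
    have := quad u x y a b
    rw [hd] at this
    apply mul_left_cancel₀ hcc
    linear_combination this
  have hker : ∀ w, δ w v v = 0 → ∀ y, δ y w v = 0 := fun w hw y => by
    have := rank y v w
    rw [hw, mul_zero] at this
    exact (mul_eq_zero.mp this).resolve_left hv
  have hss : δ s s t = 0 := by
    have e := minor (v + t) v s v s
    simp only [map_add, hs, hker s hs] at e
    have e1 := minor t v s v s
    apply mul_left_cancel₀ hv
    linear_combination e - e1
  have e := minor t s v s v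
  have e1 := hl s v t
  rw [h.symm_diff v s, hss] at e
  rw [hker t ht] at e1
  have : (l * det3 s v t) * (l * det3 s v t) = 0 := by
    linear_combination -e - (δ s v t + l * det3 s v t) * e1
  have hD' : det3 s v t ≠ 0 := by
    convert neg_ne_zero.mpr hst using 1
    simp only [det3]; ring
  exact mul_ne_zero (mul_ne_zero hl0 hD') (mul_ne_zero hl0 hD') this

/-- When `p ≠ 0`, the two forms agree. -/
lemma QuadPair.diff_eq_zero_of_ne_zero (h : QuadPair p d δ ρ σ) (h2 : (2 : k) ≠ 0) (hp : p ≠ 0)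
    (x y z : Fin 3 → k) : δ x y z = 0 := by
  obtain ⟨l, hl, h3⟩ := h.exists_skew h2 hp
  rw [h.skew_eq_zero h2 hp h3 hl] at hl
  exact trilin_eq_zero h2 δ h.symm_diff
    (h.diff_eq_zero_of_symm h2 hp fun x y z => by linear_combination hl x y z) x y z

/-- Two linear forms on `k³` have a common zero. -/
lemma exists_common_zero (a b : (Fin 3 → k) →ₗ[k] k) {x y : Fin 3 → k}
    (h : a x * b y - a y * b x ≠ 0) : ∃ e ≠ 0, a e = 0 ∧ b e = 0 := by
  refine ⟨(a (stdVec 1) * b (stdVec 2) - a (stdVec 2) * b (stdVec 1)) • stdVec 0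
    + (a (stdVec 2) * b (stdVec 0) - a (stdVec 0) * b (stdVec 2)) • stdVec 1
    + (a (stdVec 0) * b (stdVec 1) - a (stdVec 1) * b (stdVec 0)) • stdVec 2,
    fun he => h ?_, ?_, ?_⟩
  · have e0 := congrFun he 0
    have e1 := congrFun he 1
    have e2 := congrFun he 2
    simp [stdVec] at e0 e1 e2
    rw [apply_eq_coords a x, apply_eq_coords b x, apply_eq_coords a y, apply_eq_coords b y]
    simp only [stdVec]
    linear_combination (x 1 * y 2 - x 2 * y 1) * e0 + (x 2 * y 0 - x 0 * y 2) * e1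
      + (x 0 * y 1 - x 1 * y 0) * e2
  · simp only [map_add, map_smul, smul_eq_mul]; ring
  · simp only [map_add, map_smul, smul_eq_mul]; ring

lemma trilin_eq_zero_of_det3 (θ : Trilin k) {x y z : Fin 3 → k} (h : det3 x y z ≠ 0)
    (hx : ∀ a b, θ x a b = 0) (hy : ∀ a b, θ y a b = 0) (hz : ∀ a b, θ z a b = 0)
    (u a b : Fin 3 → k) : θ u a b = 0 := by
  simpa using eq_zero_of_det3 ((θ.flip a).flip b) h (by simp [hx]) (by simp [hy]) (by simp [hz]) u

lemma QuadPair.wedge_zero (h : QuadPair 0 d δ ρ σ) (u v x y : Fin 3 → k) :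
    ρ x u u * σ y v v - ρ y u u * σ x v v = ρ x v v * σ y u u - ρ y v v * σ x u u := by
  linear_combination h.rel.wedge h.rel' u v x y

lemma eq_zero_of_skew (h2 : (2 : k) ≠ 0) {e : Fin 3 → k} (h : ∀ z, ρ e z z = 0)
    (h' : ∀ z v, ρ e z v = ρ e v z) (z v : Fin 3 → k) : ρ e z v = 0 := by
  have := h (z + v)
  simp only [map_add, LinearMap.add_apply, h, h' v z] at this
  apply (mul_eq_zero.mp _).resolve_left h2
  linear_combination this

lemma QuadPair.false_of_wedge_ne_zero (h : QuadPair 0 d δ ρ σ) (h2 : (2 : k) ≠ 0) (hd : d ≠ 0)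
    (a b : (Fin 3 → k) →ₗ[k] k)
    (hw : ∀ w x y, ρ x w w * b y - ρ y w w * b x = a x * σ y w w - a y * σ x w w)
    (ht : ∀ v x y z, a x * (σ y z v - σ y v z) - a y * (σ x z v - σ x v z) =
      b x * (ρ y z v - ρ y v z) - b y * (ρ x z v - ρ x v z)) {x y : Fin 3 → k}
    (hab : a x * b y - a y * b x ≠ 0) : False := by
  obtain ⟨e, he, hae, hbe⟩ := exists_common_zero a b hab
  have indep : ∀ s t, (∀ w, s * a w = t * b w) → s = 0 ∧ t = 0 := fun s t hst => by
    constructor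
    · apply (mul_eq_zero.mp _).resolve_right hab
      linear_combination b y * hst x - b x * hst y
    · apply (mul_eq_zero.mp _).resolve_right hab
      linear_combination a y * hst x - a x * hst y
  have hdiag : ∀ w, σ e w w = 0 ∧ - ρ e w w = 0 := fun w => indep _ _ fun y => by
    have := hw w e y
    rw [hae, hbe] at this
    linear_combination this
  have hsk : ∀ z v, σ e z v - σ e v z = 0 ∧ ρ e z v - ρ e v z = 0 := fun z v =>
    indep _ _ fun y => by
      have := ht v e y z
      rw [hae, hbe] at this
      linear_combination -this
  have hσ := eq_zero_of_skew h2 (fun z => (hdiag z).1) fun z v => sub_eq_zero.mp (hsk z v).1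
  have hρ := eq_zero_of_skew h2 (fun z => neg_eq_zero.mp (hdiag z).2)
    fun z v => sub_eq_zero.mp (hsk z v).2
  have hσ' : ∀ z v, σ z e v = 0 := fun z v => by rw [h.symm_right, hσ]
  have hρ' : ∀ z v, ρ z e v = 0 := fun z v => by rw [h.symm_left, hρ]
  obtain ⟨s, t, hD⟩ := exists_det3_ne_zero he
  have i1 := h.rel e s s t t
  have i2 := h.rel' e s s t t
  have w1 := h.wedge_zero s t s t
  have w2 := h.wedge_zero (s + e) t s t
  have w3 := h.wedge_zero s (t + e) s t
  have w4 := h.wedge_zero (s + e) (t + e) s t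
  have hD' : det3 s t e = det3 e s t := by simp only [det3]; ring
  rw [hD', hρ', hρ'] at i1
  rw [hD', hσ', hσ'] at i2
  simp only [map_add, LinearMap.add_apply, hρ', hσ'] at w1 w2 w3 w4
  refine mul_ne_zero (mul_ne_zero h2 hd) (mul_ne_zero hD hD) ?_
  linear_combination i1 + i2 - w1 + w2 + w3 - w4

lemma QuadRel.false_of_eq_zero (h : QuadRel 0 d δ ρ σ) (hd : d ≠ 0)
    (h0 : (∀ x y z, ρ x y z = 0) ∨ ∀ x y z, σ x y z = 0) : False := by
  have := h (stdVec 0) (stdVec 1) (stdVec 2) (stdVec 1) (stdVec 2)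
  rcases h0 with h0 | h0 <;> simp [h0, det3, stdVec, hd.symm] at this

/-- When `p = 0`, the two forms are proportional. -/
lemma QuadPair.exists_proportional (h : QuadPair 0 d δ ρ σ) (h2 : (2 : k) ≠ 0) (hd : d ≠ 0) :
    ∃ c, (∀ x y z, σ x y z = c * ρ x y z) ∧ ∃ x y w, det3 x y w ≠ 0 ∧
      ρ x y w * σ y w x - ρ x x w * σ y w y - ρ y y w * σ x w x + ρ y x w * σ x w y =
        - (2 * d * (det3 x y w * det3 x y w)) := by
  have hN : ∀ u v x y, ρ x u u * σ y v v = ρ y u u * σ x v v := by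
    have key : ∀ u v x y, (ρ x u u + ρ x v v) * (σ y u u + σ y v v)
        - (ρ y u u + ρ y v v) * (σ x u u + σ x v v) = 0 := fun u v x y => by
      by_contra hab
      refine h.false_of_wedge_ne_zero h2 hd (((ρ.flip u).flip u) + ((ρ.flip v).flip v))
        (((σ.flip u).flip u) + ((σ.flip v).flip v)) (fun w x y => ?_) (fun w x y z => ?_)
        (x := x) (y := y) (by simpa using hab)
      · simp only [LinearMap.add_apply, LinearMap.flip_apply]
        linear_combination h.wedge_zero w u x y + h.wedge_zero w v x y
      · simp only [LinearMap.add_apply, LinearMap.flip_apply]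
        linear_combination h.rel.twist h.rel' u w x y z + h.rel.twist h.rel' v w x y z
    intro u v x y
    have k1 := key u u x y
    have k2 := key v v x y
    have k3 := key u v x y
    have k4 := h.wedge_zero u v x y
    have h8 : (8 : k) ≠ 0 := by
      convert mul_ne_zero h2 (mul_ne_zero h2 h2) using 1; norm_num
    apply mul_left_cancel₀ h8
    linear_combination 4 * k3 - k1 - k2 + 4 * k4
  obtain ⟨w, u₀, hw⟩ : ∃ x u, ρ x u u ≠ 0 := by
    by_contra! h0
    exact h.rel.false_of_eq_zero hd (Or.inl (trilin_eq_zero h2 ρ h.symm_left h0))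
  obtain ⟨w', u₁, hw'⟩ : ∃ x u, σ x u u ≠ 0 := by
    by_contra! h0
    exact h.rel.false_of_eq_zero hd (Or.inr (trilin_eq_zero h2 σ h.symm_right h0))
  obtain ⟨x, y, hx, hy, hD⟩ := exists_ker_complement (((ρ.flip u₀).flip) u₀) (u := w) (by simpa)
  have kerσ : ∀ x, ρ x u₀ u₀ = 0 → ∀ u, σ x u u = 0 := fun x hx u => by
    have := hN u₀ u w x
    rw [hx, zero_mul] at this
    exact (mul_eq_zero.mp this).resolve_left hw
  have kerρ : ∀ x, ρ x u₀ u₀ = 0 → ∀ u, ρ x u u = 0 := fun x hx u => by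
    have := hN u u₁ x w'
    rw [kerσ x hx, mul_zero] at this
    exact (mul_eq_zero.mp this).resolve_right hw'
  have skew : ∀ (τ : Trilin k) (x : Fin 3 → k), (∀ u, τ x u u = 0) → ∀ a b, τ x a b = - τ x b a :=
    fun τ x hx a b => by
      have := hx (a + b)
      simp only [map_add, LinearMap.add_apply, hx] at this
      linear_combination this
  have px := kerρ x (by simpa using hx)
  have py := kerρ y (by simpa using hy)
  have sx := kerσ x (by simpa using hx)
  have sy := kerσ y (by simpa using hy)
  have kpx := skew ρ x px
  have kpy := skew ρ y py
  have ksx := skew σ x sx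
  have ksy := skew σ y sy
  have pyx := h.symm_left y x w
  have syx := h.symm_right y x w
  have D1 : det3 x y w = det3 w x y := by simp only [det3]; ring
  have D2 : det3 w y x = - det3 w x y := by simp only [det3]; ring
  have D3 : ∀ a, det3 w a a = 0 := fun a => by simp only [det3]; ring
  have D4 : ∀ a, det3 a w w = 0 := fun a => by simp only [det3]; ring
  have r1 := h.rel w x x y y
  have r2 := h.rel w y x y x
  have r3 := h.rel w x x y x
  have r4 := h.rel w y x y y
  simp only [px, py, sx, sy, pyx, syx, D1, D2, D3] at r1 r2 r3 r4
  set m := d * (det3 w x y * det3 w x y) with hm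
  have hm0 : m ≠ 0 := mul_ne_zero hd (mul_ne_zero hD hD)
  set Δ := ρ x x w * ρ y y w - ρ x y w * ρ x y w with hΔ
  have c1 : σ x x w * Δ = -m * ρ x x w := by
    linear_combination ρ x y w * r3 - ρ x x w * r2
  have c2 : σ x y w * Δ = -m * ρ x y w := by
    linear_combination ρ y y w * r3 - ρ x y w * r2
  have c3 : σ y y w * Δ = -m * ρ y y w := by
    linear_combination ρ y y w * r1 - ρ x y w * r4
  have hΔ0 : Δ ≠ 0 := fun e => by
    rw [e, mul_zero] at c1 c2 c3
    have a1 := (mul_eq_zero.mp c1.symm).resolve_left (neg_ne_zero.mpr hm0)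
    have a2 := (mul_eq_zero.mp c2.symm).resolve_left (neg_ne_zero.mpr hm0)
    rw [a1, a2] at r1
    exact hm0 (by linear_combination r1)
  set c := -m / Δ with hc
  have cx : ∀ {a b : k}, a * Δ = -m * b → a = c * b := fun {a b} e => by
    rw [hc]; field_simp; linear_combination e
  have c1 := cx c1
  have c2 := cx c2
  have c3 := cx c3
  have row1 : ∀ t, ρ x x w * t = 0 → ρ x y w * t = 0 → t = 0 := fun t e1 e2 => by
    apply (mul_eq_zero.mp _).resolve_left hΔ0
    linear_combination ρ y y w * e1 - ρ x y w * e2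
  have row2 : ∀ t, ρ x y w * t = 0 → ρ y y w * t = 0 → t = 0 := fun t e1 e2 => by
    apply (mul_eq_zero.mp _).resolve_left hΔ0
    linear_combination ρ x x w * e2 - ρ x y w * e1
  have hh : σ w w w - c * ρ w w w = 0 := by
    have i1 := h.rel w x x w w
    have i2 := h.rel w y x w w
    simp only [px, sx, ksx w x, ksx w y, c1, c2, D3, D4] at i1 i2
    apply row1
    · linear_combination i1
    · linear_combination i2
  have hx' : σ w w x - c * ρ w w x = 0 := by
    have i1 := h.rel x w x w w
    have i2 := h.rel x w y w w
    simp only [px, py, sx, sy, ksx w x, ksy w x, kpx w x, kpy w x, syx, pyx, c1, c2, D4]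
      at i1 i2
    apply row1
    · linear_combination -i1
    · linear_combination -i2
  have hy' : σ w w y - c * ρ w w y = 0 := by
    have i1 := h.rel y w x w w
    have i2 := h.rel y w y w w
    simp only [px, py, sx, sy, ksx w y, ksy w y, kpx w y, kpy w y, c2, c3, D4] at i1 i2
    apply row2
    · linear_combination -i1
    · linear_combination -i2
  have hθ : ∀ u a b, (σ - c • ρ) u a b = 0 := by
    have symm : ∀ u a b, (σ - c • ρ) u a b = (σ - c • ρ) a u b := fun u a b => by
      simp [h.symm_left u a, h.symm_right u a]
    set θ := σ - c • ρ with hθ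
    have tx : ∀ u, θ x u u = 0 := fun u => by simp [hθ, px, sx]
    have ty : ∀ u, θ y u u = 0 := fun u => by simp [hθ, py, sy]
    have kx := skew θ x tx
    have ky := skew θ y ty
    have t1 : θ x x w = 0 := by simp [hθ, c1]
    have t2 : θ x y w = 0 := by simp [hθ, c2]
    have t3 : θ y y w = 0 := by simp [hθ, c3]
    have t5 : θ w w w = 0 := by simpa [hθ] using hh
    have t6 : θ w w x = 0 := by simpa [hθ] using hx'
    have t7 : θ w w y = 0 := by simpa [hθ] using hy'
    have xx : ∀ b, θ x x b = 0 := eq_zero_of_det3 (θ x x) hD t1 (tx x)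
      (by rw [kx, symm, ty, neg_zero])
    have xy : ∀ b, θ x y b = 0 := eq_zero_of_det3 (θ x y) hD t2 (by rw [symm, ty]) (tx y)
    have yx : ∀ b, θ y x b = 0 := fun b => by rw [symm, xy]
    have yy : ∀ b, θ y y b = 0 := eq_zero_of_det3 (θ y y) hD t3 (by rw [ky, yx, neg_zero]) (ty y)
    have xw : ∀ b, θ x w b = 0 :=
      eq_zero_of_det3 (θ x w) hD (tx w) (by rw [kx, xx, neg_zero]) (by rw [kx, xy, neg_zero])
    have yw : ∀ b, θ y w b = 0 :=
      eq_zero_of_det3 (θ y w) hD (ty w) (by rw [ky, yx, neg_zero]) (by rw [ky, yy, neg_zero])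
    have ww : ∀ b, θ w w b = 0 := eq_zero_of_det3 (θ w w) hD t5 t6 t7
    refine trilin_eq_zero_of_det3 θ hD (fun a b => ?_) (fun a b => ?_) (fun a b => ?_)
    · exact eq_zero_of_det3 ((θ w).flip b) hD (ww b)
        (by simp [symm w, xw]) (by simp [symm w, yw]) a
    · exact eq_zero_of_det3 ((θ x).flip b) hD (xw b) (xx b) (xy b) a
    · exact eq_zero_of_det3 ((θ y).flip b) hD (yw b) (yx b) (yy b) a
  refine ⟨c, fun a b e => sub_eq_zero.mp (by simpa using hθ a b e), x, y, w, D1 ▸ hD, ?_⟩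
  rw [ksy w x, ksy w y, ksx w x, ksx w y, pyx, syx, D1]
  linear_combination r1 - r2

end Quadratic

/-- The structure equations of a pair of trilinear forms describing the mixed braid relation. -/
structure BraidEqs (q : k) (r s : Trilin k) (G G' : (Fin 3 → k) → Fin 3 → k) : Prop where
  skew_left : ∀ x y z, r x y z - r y x z = -(1 + q) * det3 x y z
  skew_right : ∀ x y z, s x y z - s y x z = -(1 + q) * det3 x y z
  left : ∀ a b u x y z, r x b u * s y z a - r x a u * s y z b - r y b u * s x z a
    + r y a u * s x z b = q * (det3 x y u * det3 a b z) + det3 a b u * det3 x y (G z)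
  right : ∀ a b u x y z, s a z u * r x y b - s b z u * r x y a - s a y u * r x z b
    + s b y u * r x z a = q * (det3 a b x * det3 y z u) + det3 a b u * det3 y z (G' x)
  cross : ∀ x y z, r x y (G z) = s y z (G' x)

variable {q : k} {r s : Trilin k} {G G' : (Fin 3 → k) → Fin 3 → k}

/-- The part of a trilinear form symmetric in the first two arguments. -/
def Trilin.symmPart (t : Trilin k) : Trilin k := (2⁻¹ : k) • (t + t.flip)

lemma Trilin.eq_symmPart_sub (h2 : (2 : k) ≠ 0) {t : Trilin k}
    (ht : ∀ x y z, t x y z - t y x z = -(1 + q) * det3 x y z) (x y z : Fin 3 → k) :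
    t x y z = t.symmPart x y z - (1 + q) / 2 * det3 x y z := by
  have := ht x y z
  simp only [Trilin.symmPart, LinearMap.smul_apply, LinearMap.add_apply, LinearMap.flip_apply,
    smul_eq_mul]
  field_simp
  linear_combination this

lemma BraidEqs.quadPair (h : BraidEqs q r s G G') (h2 : (2 : k) ≠ 0) :
    QuadPair ((1 + q) / 2) (((1 + q) / 2) ^ 2 - q) (r.symmPart - s.symmPart)
      r.symmPart s.symmPart := by
  have hr := Trilin.eq_symmPart_sub h2 h.skew_left
  have hs := Trilin.eq_symmPart_sub h2 h.skew_right
  have sr : ∀ x y z, r.symmPart x y z = r.symmPart y x z := fun x y z => by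
    simp [Trilin.symmPart, add_comm]
  have ss : ∀ x y z, s.symmPart x y z = s.symmPart y x z := fun x y z => by
    simp [Trilin.symmPart, add_comm]
  have hL := h.left
  have hR := h.right
  simp only [hr, hs] at hL hR
  generalize r.symmPart = ρ at *
  generalize s.symmPart = σ at *
  generalize (1 + q) / 2 = p at *
  refine ⟨sr, ss, fun x y z => by simp, fun u v x y z => ?_, fun u v x y z => ?_⟩
  · have e := hL u v u x y z
    have p1 := det3_plucker ((ρ x).flip u) y z u v
    have p2 := det3_plucker ((ρ y).flip u) x z u v
    simp only [LinearMap.flip_apply, LinearMap.sub_apply] at p1 p2 ⊢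
    rw [sr y x u] at p2
    simp only [det3] at e p1 p2 ⊢
    linear_combination e - p * p1 + p * p2
  · have e := hR v u u z y x
    simp only [sr z y, sr z x, ss u y, ss u x, ss v y, ss v x] at e
    have p1 := det3_plucker ((σ x).flip u) y z u v
    have p2 := det3_plucker ((σ y).flip u) x z u v
    simp only [LinearMap.flip_apply, LinearMap.sub_apply] at p1 p2 ⊢
    rw [ss y x u] at p2
    simp only [det3] at e p1 p2 ⊢
    linear_combination e + p * p1 - p * p2

lemma eq_zero_of_det3_right {w : Fin 3 → k} (h : ∀ x y, det3 x y w = 0) : w = 0 := by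
  by_contra hw
  obtain ⟨y, z, hD⟩ := exists_det3_ne_zero hw
  refine hD (Eq.trans ?_ (h y z))
  simp only [det3]; ring

/-- The structure equations force the two trilinear forms to coincide. -/
theorem BraidEqs.eq (h : BraidEqs q r s G G') (h2 : (2 : k) ≠ 0) (x y z : Fin 3 → k) :
    r x y z = s x y z := by
  have hr := Trilin.eq_symmPart_sub h2 h.skew_left
  have hs := Trilin.eq_symmPart_sub h2 h.skew_right
  have hp := h.quadPair h2
  by_cases h0 : (1 + q) / 2 = 0
  swap
  · have := hp.diff_eq_zero_of_ne_zero h2 h0 x y z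
    rw [hr, hs]
    simp only [LinearMap.sub_apply] at this
    linear_combination this
  have hq : q = -1 := by
    have := (div_eq_zero_iff.mp h0).resolve_right h2
    linear_combination this
  rw [h0] at hp
  simp only [h0, zero_mul, sub_zero] at hr hs
  have hL := h.left
  have hR := h.right
  have hX := h.cross
  simp only [hr, hs] at hL hR hX ⊢
  have hd : (0 : k) ^ 2 - q = 1 := by rw [hq]; ring
  rw [hd] at hp
  generalize r.symmPart = ρ at *
  generalize s.symmPart = σ at *
  obtain ⟨c, hc, e₁, e₂, e₃, hD, hw⟩ := hp.exists_proportional h2 one_ne_zero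
  by_cases hc1 : c = 1
  · rw [hc, hc1, one_mul]
  exfalso
  simp only [hc] at hX hR
  have hG : ∀ z, G z = G' z := fun z => by
    refine sub_eq_zero.mp (eq_zero_of_det3_right fun x y => ?_)
    have i1 := hL (stdVec 0) (stdVec 1) (stdVec 2) x y z
    have i2 := hR (stdVec 1) (stdVec 0) (stdVec 2) z y x
    simp only [hc] at i1
    have e : det3 (stdVec 0) (stdVec 1) (stdVec 2) = (1 : k) := by simp [det3, stdVec]
    have e' : det3 (stdVec 1) (stdVec 0) (stdVec 2) = (-1 : k) := by simp [det3, stdVec]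
    simp only [hp.symm_left z, hp.symm_left (stdVec _)] at i2
    rw [e] at i1
    rw [e'] at i2
    have e1 : det3 (stdVec 1) (stdVec 0) z = -det3 (stdVec 0) (stdVec 1) z := by
      simp only [det3]; ring
    have e2 : det3 y x (stdVec 2) = -det3 x y (stdVec 2) := by simp only [det3]; ring
    have e3 : det3 y x (G' z) = -det3 x y (G' z) := by simp only [det3]; ring
    have e4 : det3 x y (G z - G' z) = det3 x y (G z) - det3 x y (G' z) := by
      simp only [det3, Pi.sub_apply]; ring
    rw [e1, e2, e3] at i2
    linear_combination e4 + i2 - i1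
  have key : ∀ x y z, ρ x y (G z) = 0 := by
    simp only [← hG] at hX
    have k1 : ∀ x z, ρ z x (G x) = 0 := fun x z => by
      have i1 := hX x z x
      rw [hp.symm_left x z] at i1
      apply (mul_eq_zero.mp _).resolve_left (sub_ne_zero.mpr (Ne.symm hc1))
      linear_combination i1
    have k2 : ∀ x z, ρ x x (G z) = 0 := fun x z => by
      rw [hX, hp.symm_left, k1, mul_zero]
    intro x y z
    have := k2 (x + y) z
    simp only [map_add, LinearMap.add_apply, k2, hp.symm_left y x] at this
    apply (mul_eq_zero.mp _).resolve_left h2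
    linear_combination this
  have hG0 : ∀ z, G z = 0 := fun z => by
    by_contra hg
    obtain ⟨a, b, hab⟩ := exists_det3_ne_zero hg
    have i := hp.rel (G z) a a b b
    simp only [key] at i
    have e : det3 a b (G z) = det3 (G z) a b := by simp only [det3]; ring
    rw [e] at i
    exact mul_ne_zero hab hab (by linear_combination i)
  have i := hL e₁ e₂ e₃ e₁ e₂ e₃
  rw [hw, hG0] at i
  have e : det3 e₁ e₂ (0 : Fin 3 → k) = 0 := by simp [det3]
  rw [e, hq] at i
  exact mul_ne_zero hD hD (by linear_combination -i)

end Core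

section Tensor
set_option maxSynthPendingDepth 3
variable {k V}

/-- The skew-symmetric tensors `x ⊗ y - y ⊗ x` span the degree two relations of `S(V)`. -/
def altTensors (k V : Type) [Field k] [AddCommGroup V] [Module k V] : Submodule k (V ⊗[k] V) :=
  Submodule.span k {w : V ⊗[k] V | ∃ x y : V, w = x ⊗ₜ[k] y - y ⊗ₜ[k] x}

lemma op12_assoc_tmul (R : V ⊗[k] V →ₗ[k] V ⊗[k] V) (t : V ⊗[k] V) (z : V) :
    op12 k V R (TensorProduct.assoc k V V V (t ⊗ₜ z)) =
      TensorProduct.assoc k V V V (R t ⊗ₜ z) := by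
  simp [op12]

lemma op12_tmul (R : V ⊗[k] V →ₗ[k] V ⊗[k] V) (x y z : V) :
    op12 k V R (x ⊗ₜ (y ⊗ₜ z)) = TensorProduct.assoc k V V V (R (x ⊗ₜ y) ⊗ₜ z) := by
  simp [op12]

lemma op23_tmul (R : V ⊗[k] V →ₗ[k] V ⊗[k] V) (x : V) (t : V ⊗[k] V) :
    op23 k V R (x ⊗ₜ t) = x ⊗ₜ R t := rfl

variable (b : Module.Basis (Fin 3) k V)

/-- The coordinates of a tensor of degree two. -/
def coord₂ (i j : Fin 3) : V ⊗[k] V →ₗ[k] k :=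
  (TensorProduct.lid k k).toLinearMap ∘ₗ TensorProduct.map (b.coord i) (b.coord j)

/-- The coordinates of a tensor of degree three. -/
def coord₃ (i j l : Fin 3) : V ⊗[k] (V ⊗[k] V) →ₗ[k] k :=
  (TensorProduct.lid k k).toLinearMap ∘ₗ TensorProduct.map (b.coord i) (coord₂ b j l)

lemma coord₂_tmul (i j : Fin 3) (x y : V) : coord₂ b i j (x ⊗ₜ y) = b.repr x i * b.repr y j := by
  simp [coord₂]

lemma coord₃_tmul (i j l : Fin 3) (x : V) (t : V ⊗[k] V) :
    coord₃ b i j l (x ⊗ₜ t) = b.repr x i * coord₂ b j l t := by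
  simp [coord₃]

lemma coord₃_assoc_tmul (i j l : Fin 3) (t : V ⊗[k] V) (z : V) :
    coord₃ b i j l (TensorProduct.assoc k V V V (t ⊗ₜ z)) = coord₂ b i j t * b.repr z l := by
  induction t using TensorProduct.induction_on with
  | zero => simp
  | tmul x y => simp [coord₃_tmul, coord₂_tmul, mul_assoc]
  | add x y hx hy => simp only [add_tmul, map_add, hx, hy, add_mul]

lemma coord₂_swap {t : V ⊗[k] V} (ht : t ∈ altTensors k V) (i j : Fin 3) :
    coord₂ b i j t = -coord₂ b j i t := by
  induction ht using Submodule.span_induction with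
  | mem t ht =>
    obtain ⟨x, y, rfl⟩ := ht
    simp only [map_sub, coord₂_tmul]; ring
  | zero => simp
  | add s t _ _ hs ht => simp only [map_add, hs, ht]; ring
  | smul c t _ ht => simp only [map_smul, ht, smul_neg]

lemma coord₂_self {t : V ⊗[k] V} (ht : t ∈ altTensors k V) (i : Fin 3) :
    coord₂ b i i t = 0 := by
  induction ht using Submodule.span_induction with
  | mem t ht =>
    obtain ⟨x, y, rfl⟩ := ht
    simp only [map_sub, coord₂_tmul]; ring
  | zero => simp
  | add s t _ _ hs ht => simp only [map_add, hs, ht, add_zero]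
  | smul c t _ ht => simp only [map_smul, ht, smul_zero]

/-- The element of `Λ² V` with given coordinates. -/
def wedgeVec : (Fin 3 → k) →ₗ[k] V ⊗[k] V :=
  Fintype.linearCombination k fun m => b (m + 1) ⊗ₜ[k] b (m + 2) - b (m + 2) ⊗ₜ[k] b (m + 1)

/-- The coordinates of an element of `Λ² V`. -/
def wedgeCoord : V ⊗[k] V →ₗ[k] Fin 3 → k :=
  LinearMap.pi fun m => coord₂ b (m + 1) (m + 2)

lemma wedgeVec_apply (w : Fin 3 → k) : wedgeVec b w =
    w 0 • (b 1 ⊗ₜ[k] b 2 - b 2 ⊗ₜ[k] b 1) + w 1 • (b 2 ⊗ₜ[k] b 0 - b 0 ⊗ₜ[k] b 2) +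
      w 2 • (b 0 ⊗ₜ[k] b 1 - b 1 ⊗ₜ[k] b 0) := by
  simp [wedgeVec, Fintype.linearCombination_apply, Fin.sum_univ_three]

lemma wedgeVec_mem (w : Fin 3 → k) : wedgeVec b w ∈ altTensors k V := by
  rw [wedgeVec_apply]
  refine add_mem (add_mem ?_ ?_) ?_ <;>
    exact Submodule.smul_mem _ _ (Submodule.subset_span ⟨_, _, rfl⟩)

lemma wedgeVec_wedgeCoord_tmul (x y : V) :
    wedgeVec b (wedgeCoord b (x ⊗ₜ y - y ⊗ₜ x)) = x ⊗ₜ y - y ⊗ₜ x := by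
  have hx := b.sum_repr x
  have hy := b.sum_repr y
  rw [Fin.sum_univ_three] at hx hy
  rw [wedgeVec_apply]
  simp only [wedgeCoord, LinearMap.pi_apply, map_sub, coord₂_tmul]
  conv_rhs => rw [← hx, ← hy]
  simp only [tmul_add, add_tmul, smul_tmul, tmul_smul, Fin.isValue, zero_add, Fin.reduceAdd]
  module

lemma wedgeVec_wedgeCoord {t : V ⊗[k] V} (ht : t ∈ altTensors k V) :
    wedgeVec b (wedgeCoord b t) = t := by
  induction ht using Submodule.span_induction with
  | mem t ht =>
    obtain ⟨x, y, rfl⟩ := ht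
    exact wedgeVec_wedgeCoord_tmul b x y
  | zero => simp
  | add s t _ _ hs ht => simp only [map_add, hs, ht]
  | smul c t _ ht => simp only [map_smul, ht]

/-- The trilinear form encoding an operator with image in `Λ² V`. -/
def structForm (P : V ⊗[k] V →ₗ[k] V ⊗[k] V) : Trilin k :=
  ((TensorProduct.mk k V V).compl₁₂ b.equivFun.symm.toLinearMap
    b.equivFun.symm.toLinearMap).compr₂
      (dotProductBilin k k ∘ₗ wedgeCoord b ∘ₗ P)

lemma structForm_apply (P : V ⊗[k] V →ₗ[k] V ⊗[k] V) (x y z : Fin 3 → k) :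
    structForm b P x y z =
      wedgeCoord b (P (b.equivFun.symm x ⊗ₜ b.equivFun.symm y)) ⬝ᵥ z := rfl

lemma det3_eq_cross_dotProduct (x y z : Fin 3 → k) : det3 x y z = crossProduct x y ⬝ᵥ z := by
  simp only [det3, cross_apply, dotProduct, Fin.sum_univ_three]; simp; ring

lemma repr_equivFun_symm (w : Fin 3 → k) (i : Fin 3) : b.repr (b.equivFun.symm w) i = w i := by
  rw [← b.equivFun_apply, LinearEquiv.apply_symm_apply]

lemma wedgeCoord_wedge (x y : Fin 3 → k) :
    wedgeCoord b (b.equivFun.symm x ⊗ₜ b.equivFun.symm y -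
      b.equivFun.symm y ⊗ₜ b.equivFun.symm x) = crossProduct x y := by
  ext i
  simp only [wedgeCoord, LinearMap.pi_apply, map_sub, coord₂_tmul, repr_equivFun_symm]
  fin_cases i <;> simp [cross_apply] <;> ring

lemma wedgeVec_cross (x y : Fin 3 → k) :
    wedgeVec b (crossProduct x y) = b.equivFun.symm x ⊗ₜ b.equivFun.symm y -
      b.equivFun.symm y ⊗ₜ b.equivFun.symm x := by
  rw [← wedgeCoord_wedge b, wedgeVec_wedgeCoord_tmul]

lemma wedgeCoord_wedgeVec (w : Fin 3 → k) : wedgeCoord b (wedgeVec b w) = w := by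
  ext i
  rw [wedgeVec_apply]
  simp only [wedgeCoord, LinearMap.pi_apply, map_sub, map_add, map_smul, coord₂_tmul]
  fin_cases i <;> simp

/-- Contraction of the first two factors with `u` and of the last one with `p`. -/
def contract₁₂ (u p : Fin 3 → k) : V ⊗[k] (V ⊗[k] V) →ₗ[k] k :=
  ∑ m, ∑ c, (u m * p c) • coord₃ b (m + 1) (m + 2) c

/-- Contraction of the first factor with `p` and of the last two with `u`. -/
def contract₂₃ (p u : Fin 3 → k) : V ⊗[k] (V ⊗[k] V) →ₗ[k] k :=
  ∑ c, ∑ m, (p c * u m) • coord₃ b c (m + 1) (m + 2)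

lemma contract₁₂_assoc_tmul (u p : Fin 3 → k) (t : V ⊗[k] V) (z : Fin 3 → k) :
    contract₁₂ b u p (TensorProduct.assoc k V V V (t ⊗ₜ b.equivFun.symm z)) =
      (wedgeCoord b t ⬝ᵥ u) * (p ⬝ᵥ z) := by
  simp only [contract₁₂, LinearMap.add_apply, LinearMap.smul_apply, coord₃_assoc_tmul,
    repr_equivFun_symm,
    wedgeCoord, Matrix.vec3_dotProduct, LinearMap.pi_apply, Fin.sum_univ_three, smul_eq_mul]
  ring

lemma contract₂₃_tmul (p u : Fin 3 → k) (x : Fin 3 → k) (t : V ⊗[k] V) :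
    contract₂₃ b p u (b.equivFun.symm x ⊗ₜ t) = (p ⬝ᵥ x) * (wedgeCoord b t ⬝ᵥ u) := by
  simp only [contract₂₃, LinearMap.add_apply, LinearMap.smul_apply, coord₃_tmul, repr_equivFun_symm,
    wedgeCoord, Matrix.vec3_dotProduct, LinearMap.pi_apply, Fin.sum_univ_three, smul_eq_mul]
  ring

variable {P Q : V ⊗[k] V →ₗ[k] V ⊗[k] V} {q : k}

lemma coord₃_op12 (hQ : ∀ t, Q t ∈ altTensors k V) (i j l : Fin 3) (t : V ⊗[k] (V ⊗[k] V)) :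
    coord₃ b i j l (op12 k V Q t) = -coord₃ b j i l (op12 k V Q t) ∧
      coord₃ b i i l (op12 k V Q t) = 0 := by
  obtain ⟨t, rfl⟩ := (TensorProduct.assoc k V V V).surjective t
  induction t using TensorProduct.induction_on with
  | zero => simp
  | tmul x y =>
    simp only [op12_assoc_tmul, coord₃_assoc_tmul, coord₂_self b (hQ x),
      coord₂_swap b (hQ x) i j, neg_mul, zero_mul, and_self]
  | add x y hx hy =>
    simp only [map_add, hx.2, hy.2, hx.1, hy.1, add_zero, and_true]
    ring

lemma coord₃_op23 (hP : ∀ t, P t ∈ altTensors k V) (i j l : Fin 3) (t : V ⊗[k] (V ⊗[k] V)) :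
    coord₃ b i j l (op23 k V P t) = -coord₃ b i l j (op23 k V P t) ∧
      coord₃ b i j j (op23 k V P t) = 0 := by
  induction t using TensorProduct.induction_on with
  | zero => simp
  | tmul x y =>
    simp only [op23_tmul, coord₃_tmul, coord₂_self b (hP y),
      coord₂_swap b (hP y) j l, mul_neg, mul_zero, and_self]
  | add x y hx hy =>
    simp only [map_add, hx.2, hy.2, hx.1, hy.1, add_zero, and_true]
    ring

/-- A tensor skew-symmetric in both pairs of neighbouring factors is totally skew-symmetric. -/
lemma contract_of_mem (hP : ∀ t, P t ∈ altTensors k V) (hQ : ∀ t, Q t ∈ altTensors k V)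
    {t s s' : V ⊗[k] (V ⊗[k] V)} (h : t = op12 k V Q s) (h' : t = op23 k V P s')
    (u p : Fin 3 → k) :
    contract₁₂ b u p t = (u ⬝ᵥ p) * coord₃ b 0 1 2 t ∧
      contract₂₃ b p u t = (u ⬝ᵥ p) * coord₃ b 0 1 2 t := by
  have h₁ := fun i j l => h ▸ (coord₃_op12 b hQ i j l s).1
  have h₂ := fun i l => h ▸ (coord₃_op12 b hQ i i l s).2
  have h₃ := fun i j l => h' ▸ (coord₃_op23 b hP i j l s').1
  have h₄ := fun i j => h' ▸ (coord₃_op23 b hP i j j s').2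
  have e : ∀ i j, coord₃ b i j i t = 0 := fun i j => by rw [h₁, h₄, neg_zero]
  have e₁ : coord₃ b 1 2 0 t = coord₃ b 0 1 2 t := by rw [h₃, h₁, neg_neg]
  have e₂ : coord₃ b 2 0 1 t = coord₃ b 0 1 2 t := by rw [h₁, h₃, neg_neg]
  constructor <;>
  · simp only [contract₁₂, contract₂₃, LinearMap.add_apply, LinearMap.smul_apply,
      Fin.sum_univ_three, smul_eq_mul, Fin.isValue, zero_add, Fin.reduceAdd, e, e₁, e₂, h₂, h₄,
      Matrix.vec3_dotProduct]
    ring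

lemma contract₁₂_op12 (u p w x : Fin 3 → k) :
    contract₁₂ b u p (op12 k V Q (b.equivFun.symm x ⊗ₜ wedgeVec b w)) =
      structForm b Q x (crossProduct p w) u := by
  have key : ∀ i j, contract₁₂ b u p (op12 k V Q (b.equivFun.symm x ⊗ₜ (b i ⊗ₜ b j))) =
      structForm b Q x (stdVec i) u * p j := fun i j => by
    have e : ∀ i, b.equivFun.symm (stdVec i) = b i := fun i => by simp [stdVec]
    rw [op12_tmul, ← e j, contract₁₂_assoc_tmul, structForm_apply, e i]
    simp [stdVec]
  have ex := apply_eq_coords ((structForm b Q x).flip u) (crossProduct p w)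
  simp only [LinearMap.flip_apply] at ex
  rw [ex, wedgeVec_apply]
  simp only [tmul_add, tmul_sub, tmul_smul, map_add, map_sub, map_smul, key, cross_apply,
    smul_eq_mul]
  simp
  ring

lemma contract₂₃_op23 (u p w z : Fin 3 → k) :
    contract₂₃ b p u (op23 k V P (TensorProduct.assoc k V V V
      (wedgeVec b w ⊗ₜ b.equivFun.symm z))) = structForm b P (crossProduct w p) z u := by
  have key : ∀ i j, contract₂₃ b p u (op23 k V P (b i ⊗ₜ (b j ⊗ₜ b.equivFun.symm z))) =
      p i * structForm b P (stdVec j) z u := fun i j => by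
    have e : ∀ i, b.equivFun.symm (stdVec i) = b i := fun i => by simp [stdVec]
    rw [op23_tmul, ← e i, contract₂₃_tmul, structForm_apply, e j]
    simp [stdVec]
  have ex := apply_eq_coords ((structForm b P).flip z |>.flip u) (crossProduct w p)
  simp only [LinearMap.flip_apply] at ex
  rw [ex, wedgeVec_apply]
  simp only [add_tmul, sub_tmul, ← smul_tmul', map_add, map_sub, map_smul, assoc_tmul, key,
    cross_apply, smul_eq_mul]
  simp
  ring

/-- Operators on `V ⊗ V` with image `Λ² V`, quadratic relations and a mixed braid relation. -/
structure MixedBraid (q : k) (P Q : V ⊗[k] V →ₗ[k] V ⊗[k] V) : Prop where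
  range_left : LinearMap.range P = altTensors k V
  range_right : LinearMap.range Q = altTensors k V
  apply_left : ∀ t ∈ altTensors k V, P t = (-(1 + q)) • t
  apply_right : ∀ t ∈ altTensors k V, Q t = (-(1 + q)) • t
  braid : ∀ t, op12 k V Q (op23 k V P (op12 k V Q t)) - q • op12 k V Q t =
    op23 k V P (op12 k V Q (op23 k V P t)) - q • op23 k V P t


lemma structForm_skew (hP : ∀ t ∈ altTensors k V, P t = (-(1 + q)) • t) (x y z : Fin 3 → k) :
    structForm b P x y z - structForm b P y x z = -(1 + q) * det3 x y z := by
  have hm : b.equivFun.symm x ⊗ₜ[k] b.equivFun.symm y -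
      b.equivFun.symm y ⊗ₜ b.equivFun.symm x ∈ altTensors k V :=
    Submodule.subset_span ⟨_, _, rfl⟩
  rw [structForm_apply, structForm_apply, ← sub_dotProduct, ← map_sub, ← map_sub, hP _ hm,
    map_smul, wedgeCoord_wedge, smul_dotProduct, det3_eq_cross_dotProduct, smul_eq_mul]

lemma MixedBraid.mem_left (h : MixedBraid q P Q) (t : V ⊗[k] V) : P t ∈ altTensors k V :=
  h.range_left ▸ LinearMap.mem_range_self P t

lemma MixedBraid.mem_right (h : MixedBraid q P Q) (t : V ⊗[k] V) : Q t ∈ altTensors k V :=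
  h.range_right ▸ LinearMap.mem_range_self Q t

/-- The operator `Q₁₂ P₂₃ - q` on `Λ² V ⊗ z`, in coordinates. -/
def mixLeft (P Q : V ⊗[k] V →ₗ[k] V ⊗[k] V) (q : k) (z : Fin 3 → k) :
    (Fin 3 → k) →ₗ[k] V ⊗[k] (V ⊗[k] V) :=
  (op12 k V Q ∘ₗ op23 k V P - q • LinearMap.id) ∘ₗ (TensorProduct.assoc k V V V).toLinearMap ∘ₗ
    (TensorProduct.mk k (V ⊗[k] V) V).flip (b.equivFun.symm z) ∘ₗ wedgeVec b

/-- The operator `P₂₃ Q₁₂ - q` on `x ⊗ Λ² V`, in coordinates. -/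
def mixRight (P Q : V ⊗[k] V →ₗ[k] V ⊗[k] V) (q : k) (x : Fin 3 → k) :
    (Fin 3 → k) →ₗ[k] V ⊗[k] (V ⊗[k] V) :=
  (op23 k V P ∘ₗ op12 k V Q - q • LinearMap.id) ∘ₗ
    TensorProduct.mk k V (V ⊗[k] V) (b.equivFun.symm x) ∘ₗ wedgeVec b

lemma mixLeft_apply (z w : Fin 3 → k) : mixLeft b P Q q z w =
    op12 k V Q (op23 k V P (TensorProduct.assoc k V V V (wedgeVec b w ⊗ₜ b.equivFun.symm z))) -
      q • TensorProduct.assoc k V V V (wedgeVec b w ⊗ₜ b.equivFun.symm z) := rfl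

lemma mixRight_apply (x w : Fin 3 → k) : mixRight b P Q q x w =
    op23 k V P (op12 k V Q (b.equivFun.symm x ⊗ₜ wedgeVec b w)) -
      q • (b.equivFun.symm x ⊗ₜ wedgeVec b w) := rfl

lemma MixedBraid.mixLeft_mem (h : MixedBraid q P Q) (z w : Fin 3 → k) :
    (∃ s, mixLeft b P Q q z w = op12 k V Q s) ∧ ∃ s, mixLeft b P Q q z w = op23 k V P s := by
  obtain ⟨t, ht⟩ : wedgeVec b w ∈ LinearMap.range Q := h.range_right ▸ wedgeVec_mem b w
  have e : TensorProduct.assoc k V V V (wedgeVec b w ⊗ₜ b.equivFun.symm z) =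
      op12 k V Q (TensorProduct.assoc k V V V (t ⊗ₜ b.equivFun.symm z)) := by
    rw [op12_assoc_tmul, ht]
  constructor
  · exact ⟨_, by rw [mixLeft_apply, e, ← map_smul, ← map_sub]⟩
  · exact ⟨_, by rw [mixLeft_apply, e, h.braid, ← map_smul, ← map_sub]⟩

lemma MixedBraid.mixRight_mem (h : MixedBraid q P Q) (x w : Fin 3 → k) :
    (∃ s, mixRight b P Q q x w = op12 k V Q s) ∧ ∃ s, mixRight b P Q q x w = op23 k V P s := by
  obtain ⟨t, ht⟩ : wedgeVec b w ∈ LinearMap.range P := h.range_left ▸ wedgeVec_mem b w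
  have e : b.equivFun.symm x ⊗ₜ wedgeVec b w = op23 k V P (b.equivFun.symm x ⊗ₜ t) := by
    rw [op23_tmul, ht]
  constructor
  · exact ⟨_, by rw [mixRight_apply, e, ← h.braid, ← map_smul, ← map_sub]⟩
  · exact ⟨_, by rw [mixRight_apply, e, ← map_smul, ← map_sub]⟩

lemma linearMap_eq_dotProduct (φ : (Fin 3 → k) →ₗ[k] k) (w : Fin 3 → k) :
    φ w = w ⬝ᵥ fun m => φ (stdVec m) := by
  rw [apply_eq_coords, dotProduct, Fin.sum_univ_three]

lemma cross_cross_eq (a b w : Fin 3 → k) :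
    crossProduct (crossProduct a b) w = (w ⬝ᵥ a) • b - (w ⬝ᵥ b) • a := by
  ext i
  simp only [cross_apply, dotProduct, Fin.sum_univ_three]
  fin_cases i <;> simp <;> ring

/-- The mixed braid relation in terms of the structure forms. -/
theorem MixedBraid.braidEqs (h : MixedBraid q P Q) :
    BraidEqs q (structForm b Q) (structForm b P)
      (fun z m => coord₃ b 0 1 2 (mixLeft b P Q q z (stdVec m)))
      (fun x m => coord₃ b 0 1 2 (mixRight b P Q q x (stdVec m))) where
  skew_left := structForm_skew b h.apply_right
  skew_right := structForm_skew b h.apply_left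
  left a c u x y z := by
    obtain ⟨⟨s, hs⟩, s', hs'⟩ := h.mixLeft_mem b z (crossProduct x y)
    have e := (contract_of_mem b h.mem_left h.mem_right hs hs' u (crossProduct a c)).1
    have g := linearMap_eq_dotProduct (coord₃ b 0 1 2 ∘ₗ mixLeft b P Q q z) (crossProduct x y)
    simp only [LinearMap.comp_apply] at g
    rw [g, ← det3_eq_cross_dotProduct, dotProduct_comm u, ← det3_eq_cross_dotProduct,
      mixLeft_apply, map_sub, map_smul, contract₁₂_assoc_tmul, wedgeCoord_wedgeVec,
      ← det3_eq_cross_dotProduct, ← det3_eq_cross_dotProduct, wedgeVec_cross, sub_tmul,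
      map_sub, map_sub, map_sub, assoc_tmul, assoc_tmul, op23_tmul, op23_tmul,
      ← wedgeVec_wedgeCoord b (h.mem_left (b.equivFun.symm y ⊗ₜ b.equivFun.symm z)),
      ← wedgeVec_wedgeCoord b (h.mem_left (b.equivFun.symm x ⊗ₜ b.equivFun.symm z)), map_sub,
      contract₁₂_op12, contract₁₂_op12, cross_cross_eq, cross_cross_eq] at e
    simp only [← structForm_apply, map_sub, map_smul, LinearMap.sub_apply, LinearMap.smul_apply,
      smul_eq_mul] at e
    linear_combination e
  right a c u x y z := by
    obtain ⟨⟨s, hs⟩, s', hs'⟩ := h.mixRight_mem b x (crossProduct y z)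
    have e := (contract_of_mem b h.mem_left h.mem_right hs hs' u (crossProduct a c)).2
    have g := linearMap_eq_dotProduct (coord₃ b 0 1 2 ∘ₗ mixRight b P Q q x) (crossProduct y z)
    simp only [LinearMap.comp_apply] at g
    rw [g, ← det3_eq_cross_dotProduct, dotProduct_comm u, ← det3_eq_cross_dotProduct,
      mixRight_apply, map_sub, map_smul, contract₂₃_tmul, wedgeCoord_wedgeVec,
      ← det3_eq_cross_dotProduct, ← det3_eq_cross_dotProduct, wedgeVec_cross, tmul_sub,
      map_sub, map_sub, map_sub, op12_tmul, op12_tmul,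
      ← wedgeVec_wedgeCoord b (h.mem_right (b.equivFun.symm x ⊗ₜ b.equivFun.symm y)),
      ← wedgeVec_wedgeCoord b (h.mem_right (b.equivFun.symm x ⊗ₜ b.equivFun.symm z)),
      contract₂₃_op23, contract₂₃_op23, ← cross_anticomm, ← cross_anticomm (crossProduct a c),
      cross_cross_eq, cross_cross_eq] at e
    simp only [← structForm_apply, map_sub, map_smul, map_neg, LinearMap.neg_apply,
      LinearMap.sub_apply, LinearMap.smul_apply, smul_eq_mul] at e
    linear_combination e
  cross x y z := by
    have g := linearMap_eq_dotProduct (coord₃ b 0 1 2 ∘ₗ mixLeft b P Q q z)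
    have g' := linearMap_eq_dotProduct (coord₃ b 0 1 2 ∘ₗ mixRight b P Q q x)
    simp only [LinearMap.comp_apply] at g g'
    rw [structForm_apply, structForm_apply, ← g, ← g', mixLeft_apply, mixRight_apply,
      wedgeVec_wedgeCoord b (h.mem_left _), wedgeVec_wedgeCoord b (h.mem_right _),
      ← op12_tmul, ← op23_tmul, h.braid]

theorem MixedBraid.eq (h : MixedBraid q P Q) (h2 : (2 : k) ≠ 0)
    (hdim : Module.finrank k V = 3) : P = Q := by
  have : Module.Finite k V := Module.finite_of_finrank_pos (by omega)
  let b := Module.finBasisOfFinrankEq k V hdim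
  refine TensorProduct.ext' fun x y => ?_
  rw [← wedgeVec_wedgeCoord b (h.mem_left _), ← wedgeVec_wedgeCoord b (h.mem_right _)]
  congr 1
  refine dotProduct_eq _ _ fun z => ?_
  have := (h.braidEqs b).eq h2 (b.equivFun x) (b.equivFun y) z
  simpa [structForm_apply] using this.symm

end Tensor

section Twist
variable {k V}
variable {q : k} {R A B : V ⊗[k] V →ₗ[k] V ⊗[k] V}

lemma range_conj_sub (e : (V ⊗[k] V) ≃ₗ[k] V ⊗[k] V) :
    LinearMap.range (e.conj R - q • LinearMap.id) =
      (LinearMap.range (R - q • LinearMap.id)).map e.toLinearMap := by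
  have h : e.conj R - q • LinearMap.id =
      e.toLinearMap ∘ₗ (R - q • LinearMap.id) ∘ₗ e.symm.toLinearMap := by
    ext1; ext; simp [LinearEquiv.conj_apply]
  rw [h, LinearMap.range_comp, LinearEquiv.range_comp]

lemma hecke_conj (e : (V ⊗[k] V) ≃ₗ[k] V ⊗[k] V)
    (h : (R - q • LinearMap.id) ∘ₗ (R + LinearMap.id) = 0) :
    (e.conj R - q • LinearMap.id) ∘ₗ (e.conj R + LinearMap.id) = 0 := by
  refine LinearMap.ext fun t => ?_
  have := LinearMap.congr_fun h (e.symm t)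
  simp only [LinearMap.comp_apply, LinearMap.sub_apply, LinearMap.add_apply, LinearMap.smul_apply,
    LinearMap.id_apply, LinearMap.zero_apply, LinearEquiv.conj_apply_apply] at this ⊢
  rw [map_add, e.symm_apply_apply, ← e.map_zero, ← this]
  simp only [map_sub, map_add, map_smul, e.apply_symm_apply]

lemma map_altTensors (ζ : V ≃ₗ[k] V) :
    (altTensors k V).map (TensorProduct.congr ζ ζ).toLinearMap = altTensors k V := by
  rw [altTensors, Submodule.map_span]
  congr 1
  ext w
  constructor
  · rintro ⟨_, ⟨x, y, rfl⟩, rfl⟩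
    exact ⟨ζ x, ζ y, by simp⟩
  · rintro ⟨x, y, rfl⟩
    exact ⟨_, ⟨ζ.symm x, ζ.symm y, rfl⟩, by simp⟩

lemma apply_eq_smul_of_hecke (h : (R - q • LinearMap.id) ∘ₗ (R + LinearMap.id) = 0)
    {t : V ⊗[k] V} (ht : t ∈ LinearMap.range (R - q • LinearMap.id)) :
    (R - q • (LinearMap.id : V ⊗[k] V →ₗ[k] V ⊗[k] V)) t = (-(1 + q)) • t := by
  obtain ⟨t, rfl⟩ := ht
  have := LinearMap.congr_fun h t
  simp only [LinearMap.comp_apply, LinearMap.sub_apply, LinearMap.add_apply, LinearMap.smul_apply,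
    LinearMap.id_apply, LinearMap.zero_apply, map_add, map_sub, map_smul] at this ⊢
  rw [← sub_eq_zero, ← this]; module

lemma comp_self_of_hecke (h : (R - q • LinearMap.id) ∘ₗ (R + LinearMap.id) = 0) :
    R ∘ₗ R = (q - 1) • R + q • LinearMap.id := by
  refine LinearMap.ext fun s => ?_
  have := LinearMap.congr_fun h s
  simp only [LinearMap.comp_apply, LinearMap.sub_apply, LinearMap.add_apply,
    LinearMap.smul_apply, LinearMap.id_apply, LinearMap.zero_apply, map_add] at this ⊢
  rw [← sub_eq_zero, ← this]; module

lemma op12_sub_smul (t : V ⊗[k] (V ⊗[k] V)) :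
    op12 k V (R - q • LinearMap.id) t = op12 k V R t - q • t := by
  simp [op12, LinearMap.rTensor_sub, LinearMap.rTensor_smul]

lemma op23_sub_smul (t : V ⊗[k] (V ⊗[k] V)) :
    op23 k V (R - q • LinearMap.id) t = op23 k V R t - q • t := by
  simp [op23, LinearMap.lTensor_sub, LinearMap.lTensor_smul]

lemma op12_op12_of_hecke (h : (R - q • LinearMap.id) ∘ₗ (R + LinearMap.id) = 0)
    (t : V ⊗[k] (V ⊗[k] V)) :
    op12 k V R (op12 k V R t) = (q - 1) • op12 k V R t + q • t := by
  have e : op12 k V R (op12 k V R t) = op12 k V (R ∘ₗ R) t := by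
    simp [op12, LinearMap.rTensor_comp]
  rw [e, comp_self_of_hecke h]
  simp [op12, LinearMap.rTensor_add, LinearMap.rTensor_smul]

lemma op23_op23_of_hecke (h : (R - q • LinearMap.id) ∘ₗ (R + LinearMap.id) = 0)
    (t : V ⊗[k] (V ⊗[k] V)) :
    op23 k V R (op23 k V R t) = (q - 1) • op23 k V R t + q • t := by
  have e : op23 k V R (op23 k V R t) = op23 k V (R ∘ₗ R) t := by
    simp [op23, LinearMap.lTensor_comp]
  rw [e, comp_self_of_hecke h]
  simp [op23, LinearMap.lTensor_add, LinearMap.lTensor_smul]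

lemma mixedBraid_of_hecke (hA : (A - q • LinearMap.id) ∘ₗ (A + LinearMap.id) = 0)
    (hB : (B - q • LinearMap.id) ∘ₗ (B + LinearMap.id) = 0)
    (rA : LinearMap.range (A - q • LinearMap.id) = altTensors k V)
    (rB : LinearMap.range (B - q • LinearMap.id) = altTensors k V)
    (h : op12 k V A ∘ₗ op23 k V B ∘ₗ op12 k V A = op23 k V B ∘ₗ op12 k V A ∘ₗ op23 k V B) :
    MixedBraid q (B - q • LinearMap.id) (A - q • LinearMap.id) where
  range_left := rB
  range_right := rA
  apply_left _ ht := apply_eq_smul_of_hecke hB (rB ▸ ht)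
  apply_right _ ht := apply_eq_smul_of_hecke hA (rA ▸ ht)
  braid t := by
    have := LinearMap.congr_fun h t
    simp only [LinearMap.comp_apply] at this
    simp only [op12_sub_smul, op23_sub_smul, map_sub, map_smul, this, op12_op12_of_hecke hA,
      op23_op23_of_hecke hB]
    module

lemma op23_conj (ζ : V ≃ₗ[k] V) :
    op23 k V ((LinearEquiv.rTensor V ζ).symm.conj R) =
      (TensorProduct.congr (ζ ≪≫ₗ ζ) (LinearEquiv.rTensor V ζ)).symm.conj (op23 k V R) := by
  refine TensorProduct.ext' fun x t => ?_
  simp [op23_tmul, LinearEquiv.conj_apply_apply]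

lemma op12_conj (ζ : V ≃ₗ[k] V) :
    op12 k V ((TensorProduct.congr ζ ζ ≪≫ₗ LinearEquiv.rTensor V ζ).symm.conj R) =
      (TensorProduct.congr (ζ ≪≫ₗ ζ) (LinearEquiv.rTensor V ζ)).symm.conj (op12 k V R) := by
  have h : ∀ t z, TensorProduct.congr (ζ ≪≫ₗ ζ) (LinearEquiv.rTensor V ζ)
      (TensorProduct.assoc k V V V (t ⊗ₜ z)) = TensorProduct.assoc k V V V
        ((TensorProduct.congr ζ ζ ≪≫ₗ LinearEquiv.rTensor V ζ) t ⊗ₜ z) := fun t z => by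
    induction t using TensorProduct.induction_on with
    | zero => simp
    | tmul x y => simp
    | add x y hx hy => simp only [add_tmul, map_add, hx, hy]
  refine TensorProduct.ext' fun x t => ?_
  induction t using TensorProduct.induction_on with
  | zero => simp
  | add y z hy hz => simp only [tmul_add, map_add, hy, hz]
  | tmul y z =>
    rw [op12_tmul, LinearEquiv.conj_apply_apply, LinearEquiv.conj_apply_apply,
      LinearEquiv.symm_symm, LinearEquiv.eq_symm_apply, LinearEquiv.symm_symm, h,
      LinearEquiv.apply_symm_apply, ← assoc_tmul, h, op12_assoc_tmul]

end Twist

theorem stmt1 (hchar : ringChar k ≠ 2) (hdim : Module.finrank k V = 3)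
    (ζ : V ≃ₗ[k] V) (q : k) (R : V ⊗[k] V →ₗ[k] V ⊗[k] V)
    (hR : IsHeckeSymmetry k V q R)
    (hrange : LinearMap.range (R - q • LinearMap.id) =
      Submodule.span k {w : V ⊗[k] V | ∃ x y : V, w = ζ x ⊗ₜ[k] y - ζ y ⊗ₜ[k] x}) :
    (TensorProduct.map ζ.toLinearMap ζ.toLinearMap ∘ₗ R =
      R ∘ₗ TensorProduct.map ζ.toLinearMap ζ.toLinearMap) ∧
    IsHeckeSymmetry k V q
      (LinearMap.rTensor V ζ.symm.toLinearMap ∘ₗ R ∘ₗ LinearMap.rTensor V ζ.toLinearMap) ∧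
    LinearMap.range
        ((LinearMap.rTensor V ζ.symm.toLinearMap ∘ₗ R ∘ₗ LinearMap.rTensor V ζ.toLinearMap)
          - q • LinearMap.id) =
      Submodule.span k {w : V ⊗[k] V | ∃ x y : V, w = x ⊗ₜ[k] y - y ⊗ₜ[k] x} := by
  obtain ⟨hq, hbraid, hhecke⟩ := hR
  have hB : LinearMap.rTensor V ζ.symm.toLinearMap ∘ₗ R ∘ₗ LinearMap.rTensor V ζ.toLinearMap =
    (LinearEquiv.rTensor V ζ).symm.conj R := rfl
  rw [hB]
  have rB : LinearMap.range ((LinearEquiv.rTensor V ζ).symm.conj R - q • LinearMap.id) =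
      altTensors k V := by
    rw [range_conj_sub, hrange, Submodule.map_span, altTensors]
    congr 1
    ext w
    constructor
    · rintro ⟨_, ⟨x, y, rfl⟩, rfl⟩
      exact ⟨x, y, by simp⟩
    · rintro ⟨x, y, rfl⟩
      exact ⟨_, ⟨x, y, rfl⟩, by simp⟩
  have eA : (TensorProduct.congr ζ ζ ≪≫ₗ LinearEquiv.rTensor V ζ).symm.conj R =
    (TensorProduct.congr ζ ζ).symm.conj ((LinearEquiv.rTensor V ζ).symm.conj R) := rfl
  have hmixed := mixedBraid_of_hecke (hecke_conj
      (TensorProduct.congr ζ ζ ≪≫ₗ LinearEquiv.rTensor V ζ).symm hhecke)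
    (hecke_conj (LinearEquiv.rTensor V ζ).symm hhecke)
    (by rw [eA, range_conj_sub, rB]; exact map_altTensors ζ.symm) rB
    (by rw [op12_conj, op23_conj, ← LinearEquiv.conj_comp, ← LinearEquiv.conj_comp, hbraid,
      LinearEquiv.conj_comp, LinearEquiv.conj_comp])
  have hAB := sub_left_injective (hmixed.eq (Ring.two_ne_zero hchar) hdim)
  refine ⟨?_, ⟨hq, ?_, hecke_conj _ hhecke⟩, rB⟩
  · refine LinearMap.ext fun t => ?_
    have hD := LinearMap.congr_fun hAB ((LinearEquiv.rTensor V ζ).symm t)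
    rw [eA] at hD
    simp only [LinearEquiv.conj_apply_apply, LinearEquiv.symm_symm, LinearEquiv.apply_symm_apply,
      LinearEquiv.eq_symm_apply] at hD
    have comm : ∀ s, LinearEquiv.rTensor V ζ (TensorProduct.congr ζ ζ s) =
        TensorProduct.congr ζ ζ (LinearEquiv.rTensor V ζ s) := fun s => by
      induction s using TensorProduct.induction_on with
      | zero => simp
      | tmul x y => simp
      | add x y hx hy => simp only [map_add, hx, hy]
    rw [comm, comm, LinearEquiv.apply_symm_apply, LinearEquiv.apply_symm_apply] at hD
    exact hD
  · have := congr_arg (TensorProduct.congr (ζ ≪≫ₗ ζ) (LinearEquiv.rTensor V ζ)).symm.conj hbraid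
    rwa [LinearEquiv.conj_comp, LinearEquiv.conj_comp, LinearEquiv.conj_comp,
      LinearEquiv.conj_comp, ← op12_conj, ← op23_conj, ← hAB] at this
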